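/- For all A ≤ 0 ≤ B, the worst-case null upper-crossing probability of the sequential t-test statistic is bounded by a standard normal t-statistic crossing probability: sup over μ ≤ 0 and σ > 0 of P_{μ,σ}(∃n ≥ 2: Λ(n) ≥ B and Λ(n′) > A for all 2 ≤ n′ < n) ≤ P(∃n ≥ 2: T_n ≥ b_n and T_{n′} > a_{n′} for all 2 ≤ n′ < n), where a_n = −√((n−1)(e^{(A/n)²}−1)) and b_n = √((n−1)(e^{(B/n)²}−1)). -/

import Mathlib

open MeasureTheory ProbabilityTheory Finset NNReal

/-- The sample mean `ȳ_n = n⁻¹ Σ_{j=1}^n y_j`. -/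
noncomputable def sampleMean (n : ℕ) (y : ℕ → ℝ) : ℝ := (n : ℝ)⁻¹ * ∑ j ∈ range n, y j

/-- The maximum likelihood variance estimate `σ̂_n² = n⁻¹ Σ_{j=1}^n (y_j − ȳ_n)²`. -/
noncomputable def mleVar (n : ℕ) (y : ℕ → ℝ) : ℝ :=
  (n : ℝ)⁻¹ * ∑ j ∈ range n, (y j - sampleMean n y) ^ 2

/-- The signed-root generalized likelihood ratio statistic of the sequential t-test:
`Λ(n) = +√(2nΛ_H(n))` if `ȳ_n ≥ δ/2` and `Λ(n) = −√(2nΛ_G(n))` otherwise, where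
`Λ_H(n) = (n/2)·log(1 + (ȳ_n/σ̂_n)²)` and `Λ_G(n) = (n/2)·log(1 + ((ȳ_n−δ)/σ̂_n)²)`. -/
noncomputable def signedRootGLR (δ : ℝ) (n : ℕ) (y : ℕ → ℝ) : ℝ :=
  if δ / 2 ≤ sampleMean n y then
    Real.sqrt (2 * n * ((n : ℝ) / 2 * Real.log (1 + (sampleMean n y) ^ 2 / mleVar n y)))
  else
    -Real.sqrt (2 * n * ((n : ℝ) / 2 * Real.log (1 + (sampleMean n y - δ) ^ 2 / mleVar n y)))

/-- The unbiased variance estimate `Σ_n = (n−1)⁻¹ Σ_{j=1}^n (y_j − ȳ_n)²`. -/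
noncomputable def unbiasedVar (n : ℕ) (y : ℕ → ℝ) : ℝ :=
  ((n : ℝ) - 1)⁻¹ * ∑ j ∈ range n, (y j - sampleMean n y) ^ 2

/-- The one-sample t-statistic `T_n = ȳ_n/√(Σ_n/n)`. -/
noncomputable def tStatistic (n : ℕ) (y : ℕ → ℝ) : ℝ :=
  sampleMean n y / Real.sqrt (unbiasedVar n y / n)

/-- The maximum likelihood variance estimate is positive once the first two observations differ. -/
lemma mleVar_pos {n : ℕ} (hn : 2 ≤ n) {y : ℕ → ℝ} (hy : y 0 ≠ y 1) : 0 < mleVar n y := by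
  have hn0 : (0 : ℝ) < n := by exact_mod_cast (by omega : 0 < n)
  refine mul_pos (inv_pos.2 hn0) ?_
  refine (sum_nonneg fun j _ => sq_nonneg _).lt_of_ne' fun h => hy ?_
  rw [sum_eq_zero_iff_of_nonneg fun j _ => sq_nonneg _] at h
  have h0 := h 0 (mem_range.2 (by omega))
  have h1 := h 1 (mem_range.2 (by omega))
  rw [sq_eq_zero_iff, sub_eq_zero] at h0 h1
  rw [h0, h1]

/-- The t-statistic in terms of the maximum likelihood variance estimate. -/
lemma tStatistic_eq (n : ℕ) (y : ℕ → ℝ) :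
    tStatistic n y = sampleMean n y / √(mleVar n y / ((n : ℝ) - 1)) := by
  unfold tStatistic unbiasedVar mleVar
  congr 2
  ring

lemma sampleMean_standardize {n : ℕ} (hn : 2 ≤ n) (y : ℕ → ℝ) (m s : ℝ) :
    sampleMean n (fun j => s⁻¹ * (y j + -m)) = s⁻¹ * (sampleMean n y - m) := by
  have hn0 : (n : ℝ) ≠ 0 := by exact_mod_cast (by omega : n ≠ 0)
  simp only [sampleMean, ← mul_sum, sum_add_distrib, sum_const, card_range, nsmul_eq_mul]
  field_simp
  ring

lemma mleVar_standardize {n : ℕ} (hn : 2 ≤ n) (y : ℕ → ℝ) (m s : ℝ) :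
    mleVar n (fun j => s⁻¹ * (y j + -m)) = (s⁻¹) ^ 2 * mleVar n y := by
  simp only [mleVar, sampleMean_standardize hn]
  rw [mul_left_comm, mul_sum _ _ ((s⁻¹) ^ 2)]
  congr 1
  refine sum_congr rfl fun j _ => ?_
  ring

/-- Standardizing by a nonpositive mean does not decrease the t-statistic. -/
lemma tStatistic_le_standardize {n : ℕ} (hn : 2 ≤ n) (y : ℕ → ℝ) {m s : ℝ} (hm : m ≤ 0)
    (hs : 0 < s) : tStatistic n y ≤ tStatistic n (fun j => s⁻¹ * (y j + -m)) := by
  rw [tStatistic_eq, tStatistic_eq, sampleMean_standardize hn, mleVar_standardize hn,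
    mul_div_assoc ((s⁻¹) ^ 2), Real.sqrt_mul (sq_nonneg _), Real.sqrt_sq (inv_pos.2 hs).le,
    mul_div_mul_left _ _ (inv_pos.2 hs).ne']
  gcongr
  linarith

lemma sqrt_mul_le_tStatistic_iff {n : ℕ} (hn : 2 ≤ n) {y : ℕ → ℝ} (hV : 0 < mleVar n y) (e : ℝ) :
    √(((n : ℝ) - 1) * e) ≤ tStatistic n y ↔ √(e * mleVar n y) ≤ sampleMean n y := by
  have hn1 : (0 : ℝ) < (n : ℝ) - 1 := by
    have : (2 : ℝ) ≤ n := by exact_mod_cast hn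
    linarith
  rw [tStatistic_eq, le_div_iff₀ (Real.sqrt_pos.2 (div_pos hV hn1)),
    ← Real.sqrt_mul' _ (div_pos hV hn1).le]
  congr! 2
  field_simp

lemma neg_sqrt_mul_lt_tStatistic_iff {n : ℕ} (hn : 2 ≤ n) {y : ℕ → ℝ} (hV : 0 < mleVar n y)
    (e : ℝ) :
    -√(((n : ℝ) - 1) * e) < tStatistic n y ↔ -√(e * mleVar n y) < sampleMean n y := by
  have hn1 : (0 : ℝ) < (n : ℝ) - 1 := by
    have : (2 : ℝ) ≤ n := by exact_mod_cast hn
    linarith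
  rw [tStatistic_eq, lt_div_iff₀ (Real.sqrt_pos.2 (div_pos hV hn1)), neg_mul,
    ← Real.sqrt_mul' _ (div_pos hV hn1).le]
  congr! 3
  field_simp

/-- An upper crossing of the signed-root statistic forces an upper crossing of the t-statistic. -/
lemma sqrt_le_tStatistic_of_le_signedRootGLR {δ B : ℝ} (hδ : 0 < δ) (hB : 0 ≤ B) {n : ℕ}
    (hn : 2 ≤ n) {y : ℕ → ℝ} (hy : y 0 ≠ y 1) (h : B ≤ signedRootGLR δ n y) :
    √(((n : ℝ) - 1) * (Real.exp ((B / n) ^ 2) - 1)) ≤ tStatistic n y := by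
  have hV := mleVar_pos hn hy
  have hn0 : (0 : ℝ) < n := by exact_mod_cast (by omega : 0 < n)
  rw [sqrt_mul_le_tStatistic_iff hn hV]
  unfold signedRootGLR at h
  split_ifs at h with hc
  · have hq : 0 ≤ sampleMean n y ^ 2 / mleVar n y := div_nonneg (sq_nonneg _) hV.le
    have hlog := Real.log_nonneg (le_add_of_nonneg_right hq)
    rw [Real.le_sqrt hB (by positivity)] at h
    have h' : (B / n) ^ 2 ≤ Real.log (1 + sampleMean n y ^ 2 / mleVar n y) := by
      rw [div_pow, div_le_iff₀ (by positivity)]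
      linarith
    rw [Real.le_log_iff_exp_le (by positivity)] at h'
    refine Real.sqrt_le_iff.2 ⟨by linarith, ?_⟩
    rw [← le_div_iff₀ hV]
    linarith
  · exfalso
    have hd : sampleMean n y - δ ≠ 0 := by
      push Not at hc
      linarith
    have hq : 0 < (sampleMean n y - δ) ^ 2 / mleVar n y := by positivity
    have hlog := Real.log_pos (lt_add_of_pos_right 1 hq)
    have : 0 < √(2 * n * ((n : ℝ) / 2 *
        Real.log (1 + (sampleMean n y - δ) ^ 2 / mleVar n y))) := by positivity
    linarith

/-- If the signed-root statistic stays above its lower boundary, so does the t-statistic. -/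
lemma neg_sqrt_lt_tStatistic_of_lt_signedRootGLR {δ A : ℝ} (hδ : 0 < δ) (hA : A ≤ 0) {n : ℕ}
    (hn : 2 ≤ n) {y : ℕ → ℝ} (hy : y 0 ≠ y 1) (h : A < signedRootGLR δ n y) :
    -√(((n : ℝ) - 1) * (Real.exp ((A / n) ^ 2) - 1)) < tStatistic n y := by
  have hV := mleVar_pos hn hy
  have hn0 : (0 : ℝ) < n := by exact_mod_cast (by omega : 0 < n)
  rw [neg_sqrt_mul_lt_tStatistic_iff hn hV]
  unfold signedRootGLR at h
  split_ifs at h with hc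
  · linarith [Real.sqrt_nonneg ((Real.exp ((A / n) ^ 2) - 1) * mleVar n y)]
  · push Not at hc
    have hq : 0 ≤ (sampleMean n y - δ) ^ 2 / mleVar n y := div_nonneg (sq_nonneg _) hV.le
    have hlog := Real.log_nonneg (le_add_of_nonneg_right hq)
    rw [lt_neg, Real.sqrt_lt (by positivity) (by linarith)] at h
    have h' : Real.log (1 + (sampleMean n y - δ) ^ 2 / mleVar n y) < (A / n) ^ 2 := by
      rw [div_pow, lt_div_iff₀ (by positivity)]
      linarith
    rw [Real.log_lt_iff_lt_exp (by positivity)] at h'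
    have hlt : (sampleMean n y - δ) ^ 2 < (Real.exp ((A / n) ^ 2) - 1) * mleVar n y := by
      rw [← div_lt_iff₀ hV]
      linarith
    have := Real.lt_sqrt_of_sq_lt ((sq_abs (sampleMean n y - δ)).trans_lt hlt)
    have := neg_abs_le (sampleMean n y - δ)
    linarith

lemma measurable_sampleMean (n : ℕ) : Measurable (sampleMean n) := by
  unfold sampleMean
  fun_prop

lemma measurable_tStatistic (n : ℕ) : Measurable (tStatistic n) := by
  have := measurable_sampleMean n
  unfold tStatistic unbiasedVar
  fun_prop

/-- Two independent random variables, one with an atomless law, almost surely differ. -/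
lemma ae_ne_of_indepFun {Ω : Type*} [MeasurableSpace Ω] {P : Measure Ω} [IsFiniteMeasure P]
    {U V : Ω → ℝ} (hU : Measurable U) (hV : Measurable V) (hUV : IndepFun U V P)
    (hatom : ∀ x, P.map V {x} = 0) : ∀ᵐ ω ∂P, U ω ≠ V ω := by
  have hdiag : MeasurableSet {p : ℝ × ℝ | p.1 = p.2} :=
    measurableSet_eq_fun measurable_fst measurable_snd
  have hnull : P.map (fun ω => (U ω, V ω)) {p : ℝ × ℝ | p.1 = p.2} = 0 := by
    rw [hUV.map_prod_eq_prod_map_map hU.aemeasurable hV.aemeasurable,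
      Measure.measure_prod_null hdiag]
    refine Filter.Eventually.of_forall fun x => ?_
    have : Prod.mk x ⁻¹' {p : ℝ × ℝ | p.1 = p.2} = {x} := by
      ext z
      simp [eq_comm]
    simp [this, hatom]
  rw [Measure.map_apply (hU.prodMk hV) hdiag] at hnull
  simpa [ae_iff] using hnull

/-- For all `A ≤ 0 ≤ B`, the worst-case null upper-crossing probability of the sequential
t-test statistic (data i.i.d. `Normal(m, σ²)` with `m ≤ 0`, `σ > 0`) is bounded by the
corresponding crossing probability of the one-sample t-statistic of i.i.d. standard Normal
data, with boundaries `a_n = −√((n−1)(e^{(A/n)²}−1))` and `b_n = √((n−1)(e^{(B/n)²}−1))`. -/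
theorem seq_t_test_typeI_bound {Ω Ω' : Type*} [MeasurableSpace Ω] [MeasurableSpace Ω']
    (P : Measure Ω) [IsProbabilityMeasure P] (P' : Measure Ω') [IsProbabilityMeasure P']
    (δ : ℝ) (hδ : 0 < δ) (m : ℝ) (σ : ℝ≥0) (hm : m ≤ 0) (hσ : 0 < σ)
    (X : ℕ → Ω → ℝ) (hX : ∀ j, Measurable (X j))
    (hXindep : iIndepFun X P)
    (hXdist : ∀ j, P.map (X j) = gaussianReal m (σ ^ 2))
    (Z : ℕ → Ω' → ℝ) (hZ : ∀ j, Measurable (Z j))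
    (hZindep : iIndepFun Z P')
    (hZdist : ∀ j, P'.map (Z j) = gaussianReal 0 1)
    (A B : ℝ) (hA : A ≤ 0) (hB : 0 ≤ B) :
    P {ω | ∃ n : ℕ, 2 ≤ n ∧ B ≤ signedRootGLR δ n (fun j => X j ω) ∧
        ∀ n', 2 ≤ n' → n' < n → A < signedRootGLR δ n' (fun j => X j ω)} ≤
    P' {ω | ∃ n : ℕ, 2 ≤ n ∧
        Real.sqrt (((n : ℝ) - 1) * (Real.exp ((B / n) ^ 2) - 1)) ≤
          tStatistic n (fun j => Z j ω) ∧
        ∀ n', 2 ≤ n' → n' < n →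
          -Real.sqrt (((n' : ℝ) - 1) * (Real.exp ((A / n') ^ 2) - 1)) <
            tStatistic n' (fun j => Z j ω)} := by
  have hs : (0 : ℝ) < σ := hσ
  let E : Set (ℕ → ℝ) := {z | ∃ n : ℕ, 2 ≤ n ∧
    √(((n : ℝ) - 1) * (Real.exp ((B / n) ^ 2) - 1)) ≤ tStatistic n z ∧
    ∀ n', 2 ≤ n' → n' < n →
      -√(((n' : ℝ) - 1) * (Real.exp ((A / n') ^ 2) - 1)) < tStatistic n' z}
  have hE : MeasurableSet E := by
    have := measurable_tStatistic
    simp only [E, measurableSet_setOfPred]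
    fun_prop
  let W : ℕ → Ω → ℝ := fun j ω => (σ : ℝ)⁻¹ * (X j ω + -m)
  have hg : Measurable fun x : ℝ => (σ : ℝ)⁻¹ * (x + -m) := by fun_prop
  have hW : ∀ j, Measurable (W j) := fun j => hg.comp (hX j)
  have hWindep : iIndepFun W P := hXindep.comp (fun _ x => (σ : ℝ)⁻¹ * (x + -m)) fun _ => hg
  have hWdist : ∀ j, P.map (W j) = gaussianReal 0 1 := by
    intro j
    have hcomp : W j = (fun x => (σ : ℝ)⁻¹ * x) ∘ (fun x => x + -m) ∘ X j := rfl
    rw [hcomp, ← Measure.map_map (by fun_prop) (by fun_prop),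
      ← Measure.map_map (by fun_prop) (hX j), hXdist, gaussianReal_map_add_const,
      gaussianReal_map_const_mul]
    congr 1
    · simp
    · ext
      have := hs.ne'
      push_cast
      field_simp
  have hlaw : P.map (fun ω j => W j ω) = P'.map (fun ω j => Z j ω) := by
    rw [hWindep.map_fun_eq_infinitePi_map hW, hZindep.map_fun_eq_infinitePi_map hZ]
    simp only [hWdist, hZdist]
  have hne : ∀ᵐ ω ∂P, X 0 ω ≠ X 1 ω := by
    refine ae_ne_of_indepFun (hX 0) (hX 1) (hXindep.indepFun zero_ne_one) fun x => ?_
    have : NullSingletonClass (gaussianReal m (σ ^ 2)) :=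
      nullSingletonClass_gaussianReal (pow_pos hσ 2).ne'
    rw [hXdist, measure_singleton]
  calc
    _ ≤ P ((fun ω j => W j ω) ⁻¹' E) := by
      refine measure_mono_ae ?_
      filter_upwards [hne] with ω hω
      rintro ⟨n, hn, hub, hlb⟩
      refine ⟨n, hn, ?_, fun n' hn' hlt => ?_⟩
      · exact (sqrt_le_tStatistic_of_le_signedRootGLR hδ hB hn hω hub).trans
          (tStatistic_le_standardize hn _ hm hs)
      · exact (neg_sqrt_lt_tStatistic_of_lt_signedRootGLR hδ hA hn' hω (hlb n' hn' hlt)).trans_le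
          (tStatistic_le_standardize hn' _ hm hs)
    _ = P' ((fun ω j => Z j ω) ⁻¹' E) := by
      rw [← Measure.map_apply (measurable_pi_iff.2 hW) hE, hlaw,
        Measure.map_apply (measurable_pi_iff.2 hZ) hE]
    _ ≤ _ := le_rfl
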